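/- For every finite simplicial complex K and every subcomplex L of K containing no facet of K, there exists a finite sequence of stellar subdivisions, each performed at a facet of the current relative simplicial complex, starting from S = K∖L, after which the resulting relative simplicial complex carries a shellable h-tiling. -/

import Mathlib

open Finset

variable {V : Type*} [DecidableEq V]

/-- A finite simplicial complex: a finite collection of finite sets of vertices
closed under taking subsets. -/
def IsComplex (K : Finset (Finset V)) : Prop :=
  ∀ σ ∈ K, ∀ τ ⊆ σ, τ ∈ K

/-- The set of nonempty faces of the relative simplicial complex `K ∖ L`. -/
def relFaces (K L : Finset (Finset V)) : Finset (Finset V) :=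
  (K \ L).filter (fun τ => τ ≠ ∅)

/-- A set `A` of faces is closed in `S`: every nonempty face of `S` contained in a
member of `A` belongs to `A`. -/
def closedIn (S A : Finset (Finset V)) : Prop :=
  ∀ τ ∈ S, τ ≠ ∅ → ∀ α ∈ A, τ ⊆ α → τ ∈ A

/-- A facet: a maximal face. -/
def IsFacetOf (K : Finset (Finset V)) (θ : Finset V) : Prop :=
  θ ∈ K ∧ ∀ σ ∈ K, θ ⊆ σ → σ = θ

instance (K : Finset (Finset V)) (θ : Finset V) : Decidable (IsFacetOf K θ) :=
  inferInstanceAs (Decidable (θ ∈ K ∧ ∀ σ ∈ K, θ ⊆ σ → σ = θ))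

/-- A ridge: a face of codimension one in every facet containing it. -/
def IsRidgeOf (K : Finset (Finset V)) (θ : Finset V) : Prop :=
  θ ∈ K ∧ ∀ σ, IsFacetOf K σ → θ ⊆ σ → σ.card = θ.card + 1

/-- Stellar subdivision of `K` at the face `θ`, using the new vertex `v`. -/
def stellar (K : Finset (Finset V)) (θ : Finset V) (v : V) : Finset (Finset V) :=
  K.filter (fun σ => ¬ θ ⊆ σ) ∪
    (K.filter (fun ρ => ¬ θ ⊆ ρ ∧ ρ ∪ θ ∈ K)).image (fun ρ => insert v ρ)

/-- Barycentric subdivision: faces are the chains of nonempty faces of `K`. -/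
def barySd (K : Finset (Finset V)) : Finset (Finset (Finset V)) :=
  K.powerset.filter (fun c => ∅ ∉ c ∧ ∀ τ ∈ c, ∀ τ' ∈ c, τ ⊆ τ' ∨ τ' ⊆ τ)

/-- A Morse tile: a simplex `simplex` deprived of the ridges not containing `res`,
together possibly with a Morse face `morse` of higher codimension. -/
structure MorseTile (V : Type*) where
  simplex : Finset V
  res : Finset V
  morse : Option (Finset V)
  simplex_nonempty : simplex.Nonempty
  res_sub : res ⊆ simplex
  morse_res : ∀ μ ∈ morse, res ⊆ μ
  morse_ssub : ∀ μ ∈ morse, μ ⊂ simplex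
  morse_card : ∀ μ ∈ morse, μ.card + 2 ≤ simplex.card

namespace MorseTile

/-- The face set of a Morse tile. -/
def faceSet (T : MorseTile V) : Finset (Finset V) :=
  match T.morse with
  | none => T.simplex.powerset.filter (fun τ => T.res ⊆ τ ∧ τ ≠ ∅)
  | some μ => T.simplex.powerset.filter (fun τ => T.res ⊆ τ ∧ ¬ τ ⊆ μ)

/-- The dimension of a Morse tile. -/
def dim (T : MorseTile V) : ℕ := T.simplex.card - 1

/-- The order of a Morse tile. -/
def order (T : MorseTile V) : ℕ := T.res.card

/-- The index of a (critical) Morse tile. -/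
def index (T : MorseTile V) : ℕ :=
  if T.res = T.simplex then T.simplex.card - 1 else T.res.card

/-- Basic tiles: no Morse face. -/
def IsBasic (T : MorseTile V) : Prop := T.morse = none

/-- Critical tiles: the Morse face equals the restriction set, or the open simplex. -/
def IsCritical (T : MorseTile V) : Prop := T.morse = some T.res ∨ T.res = T.simplex

/-- Tiles allowed in an h-tiling: basic or critical tiles. -/
def IsHTile (T : MorseTile V) : Prop := T.morse = none ∨ T.morse = some T.res

/-- The closed simplex. -/
def IsClosedSimplex (T : MorseTile V) : Prop := T.morse = none ∧ T.res = ∅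

/-- The open simplex. -/
def IsOpenSimplex (T : MorseTile V) : Prop := T.morse = none ∧ T.res = T.simplex

instance (T : MorseTile V) : Decidable T.IsCritical :=
  inferInstanceAs (Decidable (T.morse = some T.res ∨ T.res = T.simplex))

/-- Isomorphism of Morse tiles: a bijection between the underlying simplices mapping
the face set of one onto the face set of the other. -/
def Isom (T T' : MorseTile V) : Prop :=
  ∃ e : V → V, Set.InjOn e (T.simplex : Set V) ∧ T.simplex.image e = T'.simplex ∧
    T.faceSet.image (fun τ => τ.image e) = T'.faceSet

/-- The subcomplex `L_T` of removed faces of a Morse tile. -/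
def removed (T : MorseTile V) : Finset (Finset V) :=
  T.simplex.powerset.filter (fun τ => τ ∉ T.faceSet)

/-- The stellar subdivision of a Morse tile at a face `θ` of its underlying simplex,
as a relative simplicial complex. -/
def stellarSub (T : MorseTile V) (θ : Finset V) (v : V) : Finset (Finset V) :=
  relFaces (stellar T.simplex.powerset θ v) (stellar T.removed θ v)

end MorseTile

/-- The union of the face sets of a list of Morse tiles. -/
def faceUnion (ts : List (MorseTile V)) : Finset (Finset V) :=
  ts.foldr (fun T A => T.faceSet ∪ A) ∅

/-- A Morse tiling of the set `S` of nonempty faces of a relative complex: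
the face sets of the tiles partition `S`, and for every `d` the union of the
face sets of the tiles of dimension at least `d` is closed in `S`. -/
def IsMorseTiling (S : Finset (Finset V)) (ts : List (MorseTile V)) : Prop :=
  ts.Pairwise (fun T T' => Disjoint T.faceSet T'.faceSet) ∧
  faceUnion ts = S ∧
  ∀ d : ℕ, closedIn S (faceUnion (ts.filter (fun T => decide (d ≤ T.dim))))

/-- A Morse shelling: a Morse tiling whose order makes every initial union closed. -/
def IsMorseShelling (S : Finset (Finset V)) (ts : List (MorseTile V)) : Prop :=
  IsMorseTiling S ts ∧ ∀ p : ℕ, closedIn S (faceUnion (ts.take p))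

/-- An h-tiling: a Morse tiling all of whose tiles are basic or critical. -/
def IsHTiling (S : Finset (Finset V)) (ts : List (MorseTile V)) : Prop :=
  IsMorseTiling S ts ∧ ∀ T ∈ ts, T.IsHTile

/-- A shellable (shelled) h-tiling. -/
def IsHShelling (S : Finset (Finset V)) (ts : List (MorseTile V)) : Prop :=
  IsMorseShelling S ts ∧ ∀ T ∈ ts, T.IsHTile

/-- The number of critical tiles of index `k`. -/
def criticalCount (ts : List (MorseTile V)) (k : ℕ) : ℕ :=
  ts.countP (fun T => decide (T.IsCritical ∧ T.index = k))

/-- The total number of critical tiles. -/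
def totalCritical (ts : List (MorseTile V)) : ℕ :=
  ts.countP (fun T => decide T.IsCritical)

/-- The number of tiles of order `k`. -/
def hCount (ts : List (MorseTile V)) (k : ℕ) : ℕ :=
  ts.countP (fun T => decide (T.order = k))

/-- The number of `k`-dimensional faces. -/
def fCount (S : Finset (Finset V)) (k : ℕ) : ℕ :=
  (S.filter (fun τ => τ.card = k + 1)).card

/-- The Euler characteristic of a set of nonempty faces. -/
def eulerChar (S : Finset (Finset V)) : ℤ :=
  ∑ τ ∈ S, (-1 : ℤ) ^ (τ.card - 1)

/-- A pure `n`-dimensional complex: it has an `n`-dimensional face and all its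
facets have dimension `n`. -/
def IsPureDim (n : ℕ) (K : Finset (Finset V)) : Prop :=
  (∃ σ ∈ K, σ.card = n + 1) ∧ ∀ θ, IsFacetOf K θ → θ.card = n + 1

/-- A closed `n`-dimensional pseudo-manifold: a pure `n`-dimensional complex in
which every `(n-1)`-dimensional face is contained in exactly two facets. -/
def IsPseudoManifold (n : ℕ) (K : Finset (Finset V)) : Prop :=
  IsComplex K ∧ IsPureDim n K ∧
  ∀ ρ ∈ K, ρ.card = n → (K.filter (fun σ => IsFacetOf K σ ∧ ρ ⊆ σ)).card = 2

/-- Strong connectedness: any two facets are joined by a sequence of facets in which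
consecutive ones share an `(n-1)`-dimensional face. -/
def StronglyConnected (n : ℕ) (K : Finset (Finset V)) : Prop :=
  ∀ σ σ', IsFacetOf K σ → IsFacetOf K σ' →
    ∃ (m : ℕ) (c : ℕ → Finset V), c 0 = σ ∧ c m = σ' ∧
      (∀ i ≤ m, IsFacetOf K (c i)) ∧
      ∀ i < m, ∃ ρ : Finset V, ρ.card = n ∧ ρ ⊆ c i ∧ ρ ⊆ c (i + 1)

/-- Classical shellability of a finite simplicial complex. -/
def ClassicallyShellable (K : Finset (Finset V)) : Prop :=
  ∃ (N : ℕ) (f : Fin N → Finset V), Function.Injective f ∧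
    (∀ σ, IsFacetOf K σ ↔ ∃ i, f i = σ) ∧
    ∀ p : Fin N, 0 < (p : ℕ) →
      ∃ R : Finset V, R ≠ ∅ ∧ R ⊆ f p ∧
        ∀ τ : Finset V,
          ((τ ≠ ∅ ∧ τ ⊆ f p ∧ ∀ q, q < p → ¬ τ ⊆ f q) ↔ (R ⊆ τ ∧ τ ⊆ f p))

namespace MorseTile

theorem exists_basic {R F : Finset V} (hF : F.Nonempty) (h : R ⊆ F) :
    ∃ T : MorseTile V, T.simplex = F ∧ T.IsHTile ∧
      ∀ α, α ∈ T.faceSet ↔ R ⊆ α ∧ α ⊆ F ∧ α ≠ ∅ := by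
  refine ⟨⟨F, R, none, hF, h, by simp, by simp, by simp⟩, rfl, Or.inl rfl, fun α => ?_⟩
  simp only [faceSet, mem_filter, mem_powerset]
  tauto

theorem exists_critical {R F : Finset V} (h : R ⊂ F) :
    ∃ T : MorseTile V, T.simplex = F ∧ T.IsHTile ∧
      ∀ α, α ∈ T.faceSet ↔ R ⊂ α ∧ α ⊆ F := by
  have hF : F.Nonempty := nonempty_of_ne_empty (by rintro rfl; exact not_ssubset_empty _ h)
  by_cases hc : R.card + 2 ≤ F.card
  · refine ⟨⟨F, R, some R, hF, h.subset, ?_, ?_, ?_⟩, rfl, Or.inr rfl, fun α => ?_⟩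
    · rintro μ ⟨⟩
      exact Subset.refl _
    · rintro μ ⟨⟩
      exact h
    · rintro μ ⟨⟩
      exact hc
    · simp only [faceSet, mem_filter, mem_powerset, ssubset_def]
      tauto
  · obtain ⟨T, hT, hH, hf⟩ := exists_basic hF (Subset.refl F)
    refine ⟨T, hT, hH, fun α => ?_⟩
    rw [hf]
    constructor
    · rintro ⟨h1, h2, -⟩
      obtain rfl := Subset.antisymm h1 h2
      exact ⟨h, h1⟩
    · rintro ⟨h1, h2⟩
      have h3 := card_lt_card h1
      obtain rfl := eq_of_subset_of_card_le h2 (by omega)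
      exact ⟨h2, h2, hF.ne_empty⟩

theorem subset_simplex {T : MorseTile V} {α : Finset V} (h : α ∈ T.faceSet) :
    α ⊆ T.simplex := by
  unfold faceSet at h
  split at h <;> exact mem_powerset.1 (mem_filter.1 h).1

theorem ne_empty_of_mem {T : MorseTile V} {α : Finset V} (h : α ∈ T.faceSet) : α ≠ ∅ := by
  rintro rfl
  unfold faceSet at h
  split at h <;> simp at h

theorem simplex_mem (T : MorseTile V) : T.simplex ∈ T.faceSet := by
  have h0 := T.simplex_nonempty.ne_empty
  have h1 := T.res_sub
  have h2 := T.morse_ssub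
  unfold faceSet
  split
  · simp [h0, h1]
  · rename_i μ hμ
    have := h2 μ hμ
    simp [h1, this.not_subset]

/-- No face of the later tile `T'` lies in a face of the earlier tile `T`. -/
def Precedes (T T' : MorseTile V) : Prop :=
  ∀ τ ∈ T'.faceSet, ∀ α ∈ T.faceSet, ¬ τ ⊆ α

end MorseTile

theorem mem_faceUnion {ts : List (MorseTile V)} {τ : Finset V} :
    τ ∈ faceUnion ts ↔ ∃ T ∈ ts, τ ∈ T.faceSet := by
  induction ts with
  | nil => simp [faceUnion]
  | cons T ts ih =>
    have : faceUnion (T :: ts) = T.faceSet ∪ faceUnion ts := rfl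
    simp [this, ih]

/-- Tiles in an order of precedence whose face sets cover exactly `S`. -/
def IsPrecedenceTiling (S : Finset (Finset V)) (ts : List (MorseTile V)) : Prop :=
  ts.Pairwise MorseTile.Precedes ∧ (∀ α, α ∈ S ↔ ∃ T ∈ ts, α ∈ T.faceSet) ∧ ∀ T ∈ ts, T.IsHTile

theorem IsPrecedenceTiling.isHShelling {S : Finset (Finset V)} {ts : List (MorseTile V)}
    (h : IsPrecedenceTiling S ts)
    (hc : ts.Pairwise (fun T T' => T'.simplex.card ≤ T.simplex.card)) : IsHShelling S ts := by
  obtain ⟨hp, hS, hH⟩ := h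
  refine ⟨⟨⟨?_, ?_, ?_⟩, ?_⟩, hH⟩
  · refine hp.imp ?_
    intro T T' h
    rw [Finset.disjoint_left]
    exact fun α h1 h2 => h α h2 α h1 (Subset.refl _)
  · ext α
    rw [mem_faceUnion, hS]
  · intro d τ hτ _ α hα hτα
    rw [mem_faceUnion] at hα ⊢
    obtain ⟨T, hT, hαT⟩ := hα
    obtain ⟨T', hT', hτT'⟩ := (hS τ).1 hτ
    rw [List.mem_filter] at hT
    obtain ⟨hT, hd⟩ := hT
    refine ⟨T', List.mem_filter.2 ⟨hT', ?_⟩, hτT'⟩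
    have hd := of_decide_eq_true hd
    apply decide_eq_true
    obtain ⟨i, hi, rfl⟩ := List.getElem_of_mem hT
    obtain ⟨j, hj, rfl⟩ := List.getElem_of_mem hT'
    rcases lt_trichotomy i j with hij | rfl | hij
    · exact absurd hτα (List.pairwise_iff_getElem.1 hp i j hi hj hij τ hτT' α hαT)
    · exact hd
    · have := List.pairwise_iff_getElem.1 hc j i hj hi hij
      unfold MorseTile.dim at hd ⊢
      omega
  · intro p τ hτ _ α hα hτα
    rw [mem_faceUnion] at hα ⊢
    obtain ⟨T, hT, hαT⟩ := hα
    obtain ⟨T', hT', hτT'⟩ := (hS τ).1 hτ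
    refine ⟨T', ?_, hτT'⟩
    rw [← List.take_append_drop p ts] at hT' hp
    rcases List.mem_append.1 hT' with h | h
    · exact h
    · exact absurd hτα ((List.pairwise_append.1 hp).2.2 T hT T' h τ hτT' α hαT)

/-- The effect on the faces of a relative complex of a stellar subdivision at a facet `θ`. -/
def facetSubdivision (S : Finset (Finset V)) (θ : Finset V) (v : V) : Finset (Finset V) :=
  S.erase θ ∪ θ.ssubsets.image (insert v)

theorem mem_facetSubdivision {S : Finset (Finset V)} {θ α : Finset V} {v : V} (hv : v ∉ θ) :
    α ∈ facetSubdivision S θ v ↔ (α ≠ θ ∧ α ∈ S) ∨ (v ∈ α ∧ α.erase v ⊂ θ) := by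
  simp only [facetSubdivision, mem_union, mem_erase, mem_image, mem_ssubsets]
  refine or_congr_right ⟨?_, ?_⟩
  · rintro ⟨ρ, hρ, rfl⟩
    rw [erase_insert (fun h => hv (hρ.subset h))]
    exact ⟨mem_insert_self _ _, hρ⟩
  · rintro ⟨h1, h2⟩
    exact ⟨_, h2, insert_erase h1⟩

/-- One subdivision at a facet satisfying `Q`, with a new vertex outside `A`. -/
def FacetStep (Q : Finset V → Prop) (A : Finset V) (S S' : Finset (Finset V)) : Prop :=
  ∃ θ v, Q θ ∧ IsFacetOf S θ ∧ v ∉ A ∧ (∀ α ∈ S, v ∉ α) ∧ S' = facetSubdivision S θ v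

theorem FacetStep.mono {Q Q' : Finset V → Prop} {A A' : Finset V} {S S' : Finset (Finset V)}
    (hQ : ∀ θ, Q θ → Q' θ) (hA : A' ⊆ A) (h : FacetStep Q A S S') : FacetStep Q' A' S S' := by
  obtain ⟨θ, v, h1, h2, h3, h4⟩ := h
  exact ⟨θ, v, hQ _ h1, h2, fun h => h3 (hA h), h4⟩

open Relation (ReflTransGen)

section Reach

variable {Q : Finset V → Prop} {A : Finset V} {S S' : Finset (Finset V)}

theorem mem_or_new_vertex (h : ReflTransGen (FacetStep Q A) S S') :
    ∀ α ∈ S', α ∈ S ∨ ∃ v ∈ α, v ∉ A := by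
  induction h with
  | refl => exact fun α h => Or.inl h
  | tail _ hs ih =>
    obtain ⟨θ, v, _, hθ, hvA, hv, rfl⟩ := hs
    intro α hα
    rw [mem_facetSubdivision (hv _ hθ.1)] at hα
    rcases hα with ⟨_, h⟩ | ⟨h, _⟩
    · exact ih α h
    · exact Or.inr ⟨v, h, hvA⟩

theorem old_vertex_mem (h : ReflTransGen (FacetStep Q A) S S') {σ : Finset V}
    (hS : ∀ α ∈ S, α ⊆ σ) : ∀ α ∈ S', ∀ x ∈ α, x ∈ A → x ∈ σ := by
  induction h with
  | refl => exact fun α h x hx _ => hS α h hx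
  | tail _ hs ih =>
    obtain ⟨θ, v, _, hθ, hvA, hv, rfl⟩ := hs
    intro α hα x hx hxA
    rw [mem_facetSubdivision (hv _ hθ.1)] at hα
    rcases hα with ⟨_, h⟩ | ⟨_, h⟩
    · exact ih α h x hx hxA
    · refine ih θ hθ.1 x (h.subset (mem_erase.2 ⟨?_, hx⟩)) hxA
      rintro rfl
      exact hvA hxA

theorem mem_of_reach (h : ReflTransGen (FacetStep Q A) S S') {τ : Finset V}
    (hQ : ∀ θ, Q θ → θ ≠ τ) (hτ : τ ∈ S) : τ ∈ S' := by
  induction h with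
  | refl => exact hτ
  | tail _ hs ih =>
    obtain ⟨θ, v, hq, hθ, hvA, hv, rfl⟩ := hs
    rw [mem_facetSubdivision (hv _ hθ.1)]
    exact Or.inl ⟨(hQ θ hq).symm, ih⟩

theorem reach_union (h : ReflTransGen (FacetStep Q A) S S') {C : Finset (Finset V)}
    (hC : ∀ α ∈ C, α ⊆ A) (hSC : ∀ θ ∈ S, Q θ → ∀ α ∈ C, ¬ θ ⊆ α) :
    ReflTransGen (FacetStep Q A) (S ∪ C) (S' ∪ C) := by
  induction h with
  | refl => exact ReflTransGen.refl
  | tail hr hs ih =>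
    refine ih.tail ?_
    obtain ⟨θ, v, hq, hθ, hvA, hv, rfl⟩ := hs
    have key : ∀ α ∈ C, ¬ θ ⊆ α := by
      rcases mem_or_new_vertex hr θ hθ.1 with h | ⟨w, hw, hwA⟩
      · exact hSC θ h hq
      · exact fun α hα h => hwA (hC α hα (h hw))
    refine ⟨θ, v, hq, ⟨mem_union_left _ hθ.1, ?_⟩, hvA, ?_, ?_⟩
    · intro σ hσ hle
      rcases mem_union.1 hσ with h | h
      · exact hθ.2 σ h hle
      · exact absurd hle (key σ h)
    · intro α hα
      rcases mem_union.1 hα with h | h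
      · exact hv α h
      · exact fun h' => hvA (hC α h h')
    · ext α
      have : α ∈ C → α ≠ θ := by
        rintro h rfl
        exact key _ h (Subset.refl _)
      simp only [mem_facetSubdivision (hv _ hθ.1), mem_union]
      tauto

theorem reach_erase (h : ReflTransGen (FacetStep Q A) S S') {τ : Finset V}
    (hQ : ∀ θ, Q θ → θ ≠ τ) (hτ : τ ⊆ A) :
    ReflTransGen (FacetStep Q A) (S.erase τ) (S'.erase τ) := by
  induction h with
  | refl => exact ReflTransGen.refl
  | tail _ hs ih =>
    refine ih.tail ?_
    obtain ⟨θ, v, hq, hθ, hvA, hv, rfl⟩ := hs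
    refine ⟨θ, v, hq, ⟨mem_erase.2 ⟨hQ θ hq, hθ.1⟩, ?_⟩, hvA, ?_, ?_⟩
    · exact fun σ hσ hle => hθ.2 σ (mem_of_mem_erase hσ) hle
    · exact fun α hα => hv α (mem_of_mem_erase hα)
    · ext α
      have : v ∈ α → α ≠ τ := by
        rintro h rfl
        exact hvA (hτ h)
      simp only [mem_facetSubdivision (hv _ hθ.1), mem_erase]
      tauto

end Reach

section LocalTiling

/-- The faces `α ∈ X` with `P ⊆ α` and `P' ⊄ α` are tiled in order of precedence by
tiles of cardinality `n`. -/
def Slice (X : Finset V → Prop) (n : ℕ) (P P' : Finset V) : Prop :=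
  ∃ ts : List (MorseTile V), ts.Pairwise MorseTile.Precedes ∧
    (∀ T ∈ ts, T.IsHTile ∧ T.simplex.card = n) ∧
    ∀ α, (X α ∧ P ⊆ α ∧ ¬ P' ⊆ α) ↔ ∃ T ∈ ts, α ∈ T.faceSet

theorem Slice.refl (X : Finset V → Prop) (n : ℕ) (P : Finset V) : Slice X n P P :=
  ⟨[], by simp, by simp, by simp⟩

theorem Slice.trans {X : Finset V → Prop} {n : ℕ} {P P' P'' : Finset V} (h : Slice X n P P')
    (h' : Slice X n P' P'') (hP : P ⊆ P') (hP' : P' ⊆ P'') : Slice X n P P'' := by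
  obtain ⟨ts, hp, hH, hf⟩ := h
  obtain ⟨ts', hp', hH', hf'⟩ := h'
  refine ⟨ts ++ ts', ?_, ?_, ?_⟩
  · refine List.pairwise_append.2 ⟨hp, hp', ?_⟩
    intro T hT T' hT' τ hτ α hα hle
    exact ((hf α).2 ⟨T, hT, hα⟩).2.2 ((((hf' τ).2 ⟨T', hT', hτ⟩).2.1).trans hle)
  · intro T hT
    rcases List.mem_append.1 hT with h | h
    exacts [hH T h, hH' T h]
  · intro α
    have h1 : (∃ T ∈ ts ++ ts', α ∈ T.faceSet) ↔
        (∃ T ∈ ts, α ∈ T.faceSet) ∨ ∃ T ∈ ts', α ∈ T.faceSet := by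
      simp only [List.mem_append, or_and_right, exists_or]
    rw [h1, ← hf, ← hf']
    have h2 : P' ⊆ α → P ⊆ α := fun h => hP.trans h
    have h3 : P'' ⊆ α → P' ⊆ α := fun h => hP'.trans h
    tauto

theorem Slice.single {X : Finset V → Prop} {n : ℕ} {P : Finset V} {e : V} (T : MorseTile V)
    (hT : T.IsHTile) (hn : T.simplex.card = n)
    (hf : ∀ α, α ∈ T.faceSet ↔ X α ∧ P ⊆ α ∧ e ∉ α) : Slice X n P (insert e P) := by
  refine ⟨[T], by simp, by simp [hT, hn], fun α => ?_⟩
  simp only [List.mem_singleton, exists_eq_left, hf, insert_subset_iff]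
  tauto

theorem card_insert_erase {F : Finset V} {v e : V} (hv : v ∉ F) (he : e ∈ F) :
    (insert v (F.erase e)).card = F.card := by
  rw [card_insert_of_notMem (fun h => hv (mem_of_mem_erase h)), card_erase_add_one he]

theorem subset_insert_erase_iff {F α : Finset V} {v e : V} (hv : v ∉ F) (he : e ∈ F) :
    α ⊆ insert v (F.erase e) ↔ α.erase v ⊂ F ∧ e ∉ α := by
  have hev : e ≠ v := fun h => hv (h ▸ he)
  rw [subset_insert_iff]
  constructor
  · intro h
    refine ⟨lt_of_le_of_lt h (erase_ssubset he), fun h' => ?_⟩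
    exact notMem_erase e F (h (mem_erase.2 ⟨hev, h'⟩))
  · rintro ⟨h1, h2⟩ y hy
    refine mem_erase.2 ⟨?_, h1.subset hy⟩
    rintro rfl
    exact h2 (mem_of_mem_erase hy)

/-- The subdivision at `F` of the critical tile `(R, F]`, deprived of its minimal face
`insert x R`. -/
theorem slice_subdivided_tile {F R : Finset V} {x v : V} (hR : R ⊆ F) (hx : x ∈ F) (hxR : x ∉ R)
    (hv : v ∉ F) :
    Slice (fun α => α.erase v ⊂ F ∧ (v ∈ α ∨ R ⊂ α) ∧ α ≠ insert x R) F.card ∅ F := by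
  have hvR : v ∉ R := fun h => hv (hR h)
  have hvx : v ≠ x := fun h => hv (h ▸ hx)
  have hxF : insert x R ⊆ F := insert_subset hx hR
  have hvxR : v ∉ insert x R := fun h => hv (hxF h)
  have s1 : ∀ P : Finset V, P ⊆ R → Slice (fun α => α.erase v ⊂ F ∧ (v ∈ α ∨ R ⊂ α) ∧
      α ≠ insert x R) F.card ∅ P := by
    intro P
    induction P using Finset.induction_on with
    | empty => exact fun _ => Slice.refl _ _ _
    | insert e P he ih =>
      intro hP
      have heR := hP (mem_insert_self e P)
      have hPR := (subset_insert e P).trans hP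
      refine (ih hPR).trans ?_ (empty_subset _) (subset_insert _ _)
      obtain ⟨T, hT, hH, hf⟩ := MorseTile.exists_basic (R := insert v P)
        (insert_nonempty v (F.erase e))
        (insert_subset_insert v (subset_erase.2 ⟨hPR.trans hR, he⟩))
      refine Slice.single T hH (by rw [hT, card_insert_erase hv (hR heR)]) fun α => ?_
      rw [hf, subset_insert_erase_iff hv (hR heR), insert_subset_iff]
      constructor
      · rintro ⟨⟨h1, h2⟩, ⟨h3, h4⟩, -⟩
        exact ⟨⟨h3, Or.inl h1, fun h => hvxR (h ▸ h1)⟩, h2, h4⟩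
      · rintro ⟨⟨h3, h1, -⟩, h2, h4⟩
        have hvα : v ∈ α := h1.resolve_right fun h => h4 (h.subset heR)
        exact ⟨⟨hvα, h2⟩, ⟨h3, h4⟩, ne_empty_of_mem hvα⟩
  have s2 : Slice (fun α => α.erase v ⊂ F ∧ (v ∈ α ∨ R ⊂ α) ∧
      α ≠ insert x R) F.card R (insert x R) := by
    have hss : R ⊂ insert v (F.erase x) :=
      lt_of_le_of_lt (subset_erase.2 ⟨hR, hxR⟩)
        (ssubset_insert fun h => hv (mem_of_mem_erase h))
    obtain ⟨T, hT, hH, hf⟩ := MorseTile.exists_critical hss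
    refine Slice.single T hH (by rw [hT, card_insert_erase hv hx]) fun α => ?_
    rw [hf, subset_insert_erase_iff hv hx]
    constructor
    · rintro ⟨h1, h2, h3⟩
      exact ⟨⟨h2, Or.inr h1, fun h => h3 (h ▸ mem_insert_self x R)⟩, h1.subset, h3⟩
    · rintro ⟨⟨h2, h1, -⟩, h4, h3⟩
      refine ⟨?_, h2, h3⟩
      rcases h1 with h1 | h1
      · exact (ssubset_iff_of_subset h4).2 ⟨v, h1, hvR⟩
      · exact h1
  have s3 : ∀ P : Finset V, P ⊆ F → Disjoint P (insert x R) →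
      Slice (fun α => α.erase v ⊂ F ∧ (v ∈ α ∨ R ⊂ α) ∧
      α ≠ insert x R) F.card (insert x R) (P ∪ insert x R) := by
    intro P
    induction P using Finset.induction_on with
    | empty =>
      intro _ _
      rw [empty_union]
      exact Slice.refl _ _ _
    | insert e P he ih =>
      intro hP hd
      obtain ⟨heF, hPF⟩ := insert_subset_iff.1 hP
      rw [disjoint_insert_left] at hd
      rw [insert_union]
      refine (ih hPF hd.2).trans ?_ subset_union_right (subset_insert _ _)
      have heP : e ∉ P ∪ insert x R := fun h => (mem_union.1 h).elim he hd.1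
      have hss : P ∪ insert x R ⊂ insert v (F.erase e) :=
        lt_of_le_of_lt (subset_erase.2 ⟨union_subset hPF hxF, heP⟩)
          (ssubset_insert fun h => hv (mem_of_mem_erase h))
      have hRα : ∀ α, P ∪ insert x R ⊆ α → R ⊂ α := fun α h =>
        lt_of_lt_of_le (ssubset_insert hxR) (subset_union_right.trans h)
      rcases P.eq_empty_or_nonempty with rfl | ⟨p, hp⟩
      · rw [empty_union] at *
        obtain ⟨T, hT, hH, hf⟩ := MorseTile.exists_critical hss
        refine Slice.single T hH (by rw [hT, card_insert_erase hv heF]) fun α => ?_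
        rw [hf, subset_insert_erase_iff hv heF]
        constructor
        · rintro ⟨h1, h2, h3⟩
          exact ⟨⟨h2, Or.inr (hRα α (by simpa using h1.subset)), h1.ne'⟩, h1.subset, h3⟩
        · rintro ⟨⟨h2, -, h4⟩, h1, h3⟩
          exact ⟨lt_of_le_of_ne h1 (Ne.symm h4), h2, h3⟩
      · obtain ⟨T, hT, hH, hf⟩ := MorseTile.exists_basic (insert_nonempty v (F.erase e)) hss.subset
        refine Slice.single T hH (by rw [hT, card_insert_erase hv heF]) fun α => ?_
        rw [hf, subset_insert_erase_iff hv heF]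
        constructor
        · rintro ⟨h1, ⟨h2, h3⟩, -⟩
          refine ⟨⟨h2, Or.inr (hRα α h1), ?_⟩, h1, h3⟩
          rintro rfl
          exact disjoint_left.1 hd.2 hp (h1 (mem_union_left _ hp))
        · rintro ⟨⟨h2, -, -⟩, h1, h3⟩
          exact ⟨h1, ⟨h2, h3⟩, ne_empty_of_mem (h1 (mem_union_left _ hp))⟩
  have s4 := s3 (F \ insert x R) sdiff_subset sdiff_disjoint
  rw [sdiff_union_of_subset hxF] at s4
  exact (((s1 R (Subset.refl R)).trans s2 (empty_subset _) (subset_insert _ _)).trans s4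
    (empty_subset _) hxF)

end LocalTiling

/-- Replacing, in an ordered tiling, a tile by an ordered tiling of a modification of it. -/
theorem IsPrecedenceTiling.replace {S S' : Finset (Finset V)} {l₁ l₂ ts : List (MorseTile V)}
    {T : MorseTile V} (h : IsPrecedenceTiling S (l₁ ++ T :: l₂))
    (hp : ts.Pairwise MorseTile.Precedes) (hH : ∀ T' ∈ ts, T'.IsHTile)
    (hnew : ∀ T' ∈ ts, ∀ α ∈ T'.faceSet,
      α ∈ T.faceSet ∨ ∃ v ∈ α, (∀ β ∈ S, v ∉ β) ∧ α.erase v ⊆ T.simplex)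
    (hS' : ∀ α, α ∈ S' ↔ (α ∈ S ∧ α ∉ T.faceSet) ∨ ∃ T' ∈ ts, α ∈ T'.faceSet) :
    IsPrecedenceTiling S' (l₁ ++ (ts ++ l₂)) := by
  obtain ⟨hP, hS, hHT⟩ := h
  obtain ⟨hP1, hP2, hP12⟩ := List.pairwise_append.1 hP
  obtain ⟨hTl, hP2⟩ := List.pairwise_cons.1 hP2
  have hdis : ∀ T₁ T₂ : MorseTile V, T₁.Precedes T₂ → ∀ α ∈ T₁.faceSet, α ∉ T₂.faceSet :=
    fun T₁ T₂ h α h1 h2 => h α h2 α h1 (Subset.refl _)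
  refine ⟨?_, ?_, ?_⟩
  · refine List.pairwise_append.2 ⟨hP1, List.pairwise_append.2 ⟨hp, hP2, ?_⟩, ?_⟩
    · intro T' hT' T₂ hT₂ τ hτ α hα hle
      rcases hnew T' hT' α hα with h | ⟨v, hvα, hv, hsub⟩
      · exact hTl T₂ hT₂ τ hτ α h hle
      · refine hTl T₂ hT₂ τ hτ _ T.simplex_mem (subset_trans ?_ hsub)
        exact subset_erase.2 ⟨hle, hv τ ((hS τ).2 ⟨T₂, by simp [hT₂], hτ⟩)⟩
    · intro T₁ hT₁ T' hT'
      rcases List.mem_append.1 hT' with hT' | hT'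
      · intro τ hτ α hα hle
        rcases hnew T' hT' τ hτ with h | ⟨v, hvα, hv, -⟩
        · exact hP12 T₁ hT₁ T (by simp) τ h α hα hle
        · exact hv α ((hS α).2 ⟨T₁, by simp [hT₁], hα⟩) (hle hvα)
      · exact hP12 T₁ hT₁ T' (by simp [hT'])
  · intro α
    have h1 : (α ∈ S ∧ α ∉ T.faceSet) ↔
        (∃ T ∈ l₁, α ∈ T.faceSet) ∨ ∃ T ∈ l₂, α ∈ T.faceSet := by
      rw [hS]
      constructor
      · rintro ⟨⟨T₁, hT₁, hα⟩, hn⟩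
        rcases List.mem_append.1 hT₁ with h | h
        · exact Or.inl ⟨T₁, h, hα⟩
        · rcases List.mem_cons.1 h with rfl | h
          · exact absurd hα hn
          · exact Or.inr ⟨T₁, h, hα⟩
      · rintro (⟨T₁, hT₁, hα⟩ | ⟨T₁, hT₁, hα⟩)
        · exact ⟨⟨T₁, by simp [hT₁], hα⟩, hdis _ _ (hP12 T₁ hT₁ T (by simp)) α hα⟩
        · exact ⟨⟨T₁, by simp [hT₁], hα⟩, fun h => hdis _ _ (hTl T₁ hT₁) α h hα⟩
    rw [hS', h1]
    simp only [List.mem_append, or_and_right, exists_or]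
    rw [or_assoc]
    exact or_congr_right or_comm
  · intro T' hT'
    simp only [List.mem_append] at hT'
    rcases hT' with h | h | h
    · exact hHT T' (by simp [h])
    · exact hH T' h
    · exact hHT T' (by simp [h])

theorem MorseTile.minimal_face {T : MorseTile V} (hT : T.IsHTile) {τ : Finset V}
    (hτ : τ ∈ T.faceSet) (hmin : ∀ ρ ∈ T.faceSet, ρ ⊆ τ → ρ = τ) :
    (∀ α, α ∈ T.faceSet ↔ τ ⊆ α ∧ α ⊆ T.simplex) ∨
    ∃ R x, R ⊆ T.simplex ∧ x ∈ T.simplex ∧ x ∉ R ∧ τ = insert x R ∧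
      ∀ α, α ∈ T.faceSet ↔ R ⊂ α ∧ α ⊆ T.simplex := by
  have hτF := T.subset_simplex hτ
  have hτ0 := T.ne_empty_of_mem hτ
  have crit : ∀ R, R ⊆ T.simplex → (∀ α, α ∈ T.faceSet ↔ R ⊂ α ∧ α ⊆ T.simplex) →
      ∃ R x, R ⊆ T.simplex ∧ x ∈ T.simplex ∧ x ∉ R ∧ τ = insert x R ∧
      ∀ α, α ∈ T.faceSet ↔ R ⊂ α ∧ α ⊆ T.simplex := by
    intro R hR hf
    obtain ⟨hRτ, -⟩ := (hf τ).1 hτ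
    obtain ⟨x, hx, hxR⟩ := exists_of_ssubset hRτ
    refine ⟨R, x, hR, hτF hx, hxR, ?_, hf⟩
    exact (hmin _ ((hf _).2 ⟨ssubset_insert hxR, insert_subset (hτF hx) hR⟩)
      (insert_subset hx hRτ.subset)).symm
  rcases hT with h | h
  · have hf : ∀ α, α ∈ T.faceSet ↔ T.res ⊆ α ∧ α ⊆ T.simplex ∧ α ≠ ∅ := by
      intro α
      simp only [faceSet, h, mem_filter, mem_powerset]
      tauto
    by_cases h0 : T.res = ∅
    · refine Or.inr (crit ∅ (empty_subset _) fun α => ?_)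
      rw [hf, h0, empty_ssubset, nonempty_iff_ne_empty]
      simp [and_comm]
    · left
      have := hmin T.res ((hf _).2 ⟨Subset.refl _, T.res_sub, h0⟩) ((hf τ).1 hτ).1
      intro α
      rw [hf, this]
      refine ⟨fun h => ⟨h.1, h.2.1⟩, fun h => ⟨h.1, h.2, ?_⟩⟩
      rintro rfl
      exact hτ0 (subset_empty.1 h.1)
  · right
    refine crit T.res T.res_sub fun α => ?_
    simp only [faceSet, h, mem_filter, mem_powerset, ssubset_def]
    tauto

/-- A minimal face which is not a facet can be removed from an ordered tiling by tiles of
constant dimension, after at most one subdivision at a facet. -/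
theorem exists_reach_erase [Infinite V] {S : Finset (Finset V)} {ts : List (MorseTile V)} {n : ℕ}
    (A : Finset V) (h : IsPrecedenceTiling S ts) (hn : ∀ T ∈ ts, T.simplex.card = n)
    {τ : Finset V} (hτ : τ ∈ S) (hτA : τ ⊆ A) (hτn : τ.card < n)
    (hmin : ∀ ρ ∈ S, ρ ⊆ τ → ρ = τ) :
    ∃ S' ts', ReflTransGen (FacetStep (fun θ => θ.card = n) A) S S' ∧
      IsPrecedenceTiling (S'.erase τ) ts' ∧ ∀ T ∈ ts', T.simplex.card = n := by
  have hS := h.2.1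
  obtain ⟨T, hT, hτT⟩ := (hS τ).1 hτ
  have hTS : ∀ α ∈ T.faceSet, α ∈ S := fun α hα => (hS α).2 ⟨T, hT, hα⟩
  obtain ⟨l₁, l₂, rfl⟩ := List.append_of_mem hT
  have hTn := hn T hT
  have hmem : ∀ {ts' : List (MorseTile V)}, (∀ T ∈ ts', T.simplex.card = n) →
      ∀ T ∈ l₁ ++ (ts' ++ l₂), T.simplex.card = n := by
    intro ts' h' T' hT'
    simp only [List.mem_append] at hT'
    rcases hT' with h | h | h
    · exact hn T' (by simp [h])
    · exact h' T' h
    · exact hn T' (by simp [h])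
  rcases T.minimal_face (h.2.2 T hT) hτT (fun ρ hρ => hmin ρ (hTS ρ hρ)) with
    hf | ⟨R, x, hR, hx, hxR, rfl, hf⟩
  · have hss : τ ⊂ T.simplex := lt_of_le_of_ne (T.subset_simplex hτT) (by
      rintro rfl
      omega)
    obtain ⟨T', hT', hH', hf'⟩ := MorseTile.exists_critical hss
    have hsub : ∀ α, α ∈ T'.faceSet ↔ α ∈ T.faceSet ∧ α ≠ τ := by
      intro α
      rw [hf, hf']
      constructor
      · rintro ⟨h1, h2⟩
        exact ⟨⟨h1.subset, h2⟩, h1.ne'⟩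
      · rintro ⟨⟨h1, h2⟩, h3⟩
        exact ⟨lt_of_le_of_ne h1 (Ne.symm h3), h2⟩
    refine ⟨S, l₁ ++ ([T'] ++ l₂), ReflTransGen.refl, h.replace (by simp) (by simpa using hH') ?_ ?_,
      hmem (by simp [hT', hTn])⟩
    · intro T'' hT'' α hα
      obtain rfl := List.mem_singleton.1 hT''
      exact Or.inl ((hsub α).1 hα).1
    · intro α
      simp only [List.mem_singleton, exists_eq_left, hsub, mem_erase]
      have h1 := hTS α
      have h2 : α = τ → α ∈ T.faceSet := fun h => h ▸ hτT
      tauto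
  · obtain ⟨v, hv⟩ := Infinite.exists_notMem_finset (A ∪ S.sup id)
    rw [mem_union, not_or] at hv
    obtain ⟨hvA, hvS⟩ := hv
    have hvS : ∀ α ∈ S, v ∉ α := fun α hα h => hvS (mem_sup.2 ⟨α, hα, h⟩)
    have hvF := hvS _ (hTS _ T.simplex_mem)
    have hfac : IsFacetOf S T.simplex := by
      refine ⟨hTS _ T.simplex_mem, fun σ hσ hle => ?_⟩
      obtain ⟨T₁, hT₁, hσ₁⟩ := (hS σ).1 hσ
      refine (eq_of_subset_of_card_le hle ?_).symm
      have := card_le_card (T₁.subset_simplex hσ₁)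
      rw [hn T₁ hT₁] at this
      omega
    obtain ⟨ts, hp, hH, hts⟩ := slice_subdivided_tile hR hx hxR hvF
    have hX : ∀ α, (∃ T' ∈ ts, α ∈ T'.faceSet) ↔
        α.erase v ⊂ T.simplex ∧ (v ∈ α ∨ R ⊂ α) ∧ α ≠ insert x R := by
      intro α
      rw [← hts]
      refine ⟨fun h => h.1, fun h => ⟨h, empty_subset _, fun hle => ?_⟩⟩
      exact h.1.not_subset (subset_erase.2 ⟨hle, hvF⟩)
    refine ⟨facetSubdivision S T.simplex v, l₁ ++ (ts ++ l₂),
      ReflTransGen.single ⟨T.simplex, v, hTn, hfac, hvA, hvS, rfl⟩,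
      h.replace hp (fun T' hT' => (hH T' hT').1) ?_ ?_,
      hmem (fun T' hT' => (hH T' hT').2.trans hTn)⟩
    · intro T' hT' α hα
      obtain ⟨h1, h2, -⟩ := (hX α).1 ⟨T', hT', hα⟩
      by_cases hvα : v ∈ α
      · exact Or.inr ⟨v, hvα, hvS, h1.subset⟩
      · rw [erase_eq_of_notMem hvα] at h1
        exact Or.inl ((hf α).2 ⟨h2.resolve_left hvα, h1.subset⟩)
    · intro α
      rw [hX, mem_erase, mem_facetSubdivision hvF]
      have h1 : α ∈ S → v ∉ α := hvS α
      have h2 := hf α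
      have h3 : v ∉ α → α.erase v = α := erase_eq_of_notMem
      have h4 : α = insert x R → α ∈ T.faceSet := fun h => h ▸ hτT
      have h5 : α ⊂ T.simplex ↔ α ⊆ T.simplex ∧ α ≠ T.simplex := Finset.ssubset_iff_subset_ne
      have h6 := hTS α
      by_cases hvα : v ∈ α
      · have h7 : α ∉ S := fun h => h1 h hvα
        simp only [hvα, h7, true_and, false_and, and_false, false_or, true_or]
        exact and_comm
      · simp only [h3 hvα, hvα, false_and, or_false, false_or, h5]
        have h7 : α = T.simplex → α ∈ T.faceSet := fun h => h ▸ T.simplex_mem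
        clear * - h2 h4 h6 h7
        tauto

/-- A simplex `σ` deprived of a set `M` of proper faces closed under taking nonempty subsets. -/
theorem exists_tiling_simplex [Infinite V] {σ : Finset V} (hσ : σ.Nonempty) (A : Finset V)
    (hσA : σ ⊆ A) (M : Finset (Finset V)) (hM : ∀ τ ∈ M, τ ≠ ∅ ∧ τ ⊂ σ)
    (hdown : ∀ τ ∈ M, ∀ ρ ⊆ τ, ρ ≠ ∅ → ρ ∈ M) :
    ∃ S ts, ReflTransGen (FacetStep (fun θ => θ.card = σ.card) A)
        (σ.powerset.filter (fun τ => τ ≠ ∅ ∧ τ ∉ M)) S ∧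
      IsPrecedenceTiling S ts ∧ ∀ T ∈ ts, T.simplex.card = σ.card := by
  induction M using Finset.induction_on_max_value (fun τ : Finset V => τ.card) with
  | empty =>
    obtain ⟨T, hT, hH, hf⟩ := MorseTile.exists_basic hσ (empty_subset σ)
    refine ⟨_, [T], ReflTransGen.refl, ⟨by simp, ?_, by simpa using hH⟩, by simp [hT]⟩
    intro α
    simp [hf]
  | insert τ M hτM hmax ih =>
    have hdown' : ∀ τ ∈ M, ∀ ρ ⊆ τ, ρ ≠ ∅ → ρ ∈ M := by
      intro α hα ρ hρ hρ0
      rcases mem_insert.1 (hdown α (mem_insert_of_mem hα) ρ hρ hρ0) with rfl | h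
      · exact absurd (eq_of_subset_of_card_le hρ (hmax α hα) ▸ hα) hτM
      · exact h
    obtain ⟨S, ts, hr, hts, hn⟩ := ih (fun α hα => hM α (mem_insert_of_mem hα)) hdown'
    obtain ⟨hτ0, hτσ⟩ := hM τ (mem_insert_self _ _)
    have hcard := card_lt_card hτσ
    have hτA := hτσ.subset.trans hσA
    have hQ : ∀ θ : Finset V, θ.card = σ.card → θ ≠ τ := by
      rintro θ h rfl
      omega
    have hτS : τ ∈ S := mem_of_reach hr hQ (by simp [hτσ.subset, hτ0, hτM])
    have hmin : ∀ ρ ∈ S, ρ ⊆ τ → ρ = τ := by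
      intro ρ hρ hle
      rcases mem_or_new_vertex hr ρ hρ with h | ⟨v, hv, hvA⟩
      · simp only [mem_filter, mem_powerset] at h
        exact (mem_insert.1 (hdown τ (mem_insert_self _ _) ρ hle h.2.1)).resolve_right h.2.2
      · exact absurd (hτA (hle hv)) hvA
    obtain ⟨S', ts', hr', hts', hn'⟩ := exists_reach_erase A hts hn hτS hτA hcard hmin
    refine ⟨S'.erase τ, ts', ?_, hts', hn'⟩
    have := reach_erase (hr.trans hr') hQ hτA
    convert this using 1
    ext α
    simp only [mem_filter, mem_powerset, mem_insert, mem_erase]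
    tauto

/-- The union of a list of simplices, deprived of a subcomplex. -/
theorem exists_tiling_facets [Infinite V] (σs : List (Finset V))
    (hne : ∀ σ ∈ σs, σ.Nonempty)
    (hσs : σs.Pairwise (fun σ σ' => σ'.card ≤ σ.card ∧ ¬ σ' ⊆ σ)) (A : Finset V)
    (hA : ∀ σ ∈ σs, σ ⊆ A) (L : Finset (Finset V)) (hL : IsComplex L) (hσL : ∀ σ ∈ σs, σ ∉ L)
    (S : Finset (Finset V))
    (hS : ∀ α, α ∈ S ↔ α ≠ ∅ ∧ α ∉ L ∧ ∃ σ ∈ σs, α ⊆ σ) :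
    ∃ S' ts, ReflTransGen (FacetStep (fun _ => True) A) S S' ∧
      IsPrecedenceTiling S' ts ∧
      ts.Pairwise (fun T T' => T'.simplex.card ≤ T.simplex.card) ∧
      ∀ T ∈ ts, ∃ σ ∈ σs, T.simplex.card = σ.card := by
  induction σs generalizing L S with
  | nil => exact ⟨S, [], ReflTransGen.refl, ⟨by simp, by simpa using hS, by simp⟩, by simp, by simp⟩
  | cons σ σs ih =>
    obtain ⟨hσ, hσs⟩ := List.pairwise_cons.1 hσs
    have hσA := hA σ (by simp)
    have hσL0 := hσL σ (by simp)
    set B := σ.powerset.filter (fun τ => τ ≠ ∅ ∧ τ ∉ L) with hB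
    set C := S.filter (fun τ => ¬ τ ⊆ σ) with hC
    have hSBC : S = C ∪ B := by
      ext α
      have h1 : α ⊆ σ → ∃ σ' ∈ σ :: σs, α ⊆ σ' := fun h => ⟨σ, by simp, h⟩
      simp only [hB, hC, mem_union, mem_filter, mem_powerset, hS]
      generalize (∃ σ' ∈ σ :: σs, α ⊆ σ') = p at h1 ⊢
      tauto
    obtain ⟨C', ts', hr', hts', hc', hn'⟩ := ih (fun σ' h => hne σ' (by simp [h])) hσs
      (fun σ' h => hA σ' (by simp [h])) (L ∪ σ.powerset)
      (by
        intro α hα ρ hρ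
        rcases mem_union.1 hα with h | h
        · exact mem_union_left _ (hL α h ρ hρ)
        · exact mem_union_right _ (mem_powerset.2 (hρ.trans (mem_powerset.1 h))))
      (by
        intro σ' h'
        rw [mem_union, mem_powerset, not_or]
        exact ⟨hσL σ' (by simp [h']), (hσ σ' h').2⟩) C
      (by
        intro α
        simp only [hC, mem_filter, hS, mem_union, mem_powerset, List.mem_cons, or_and_right,
          exists_or, exists_eq_left]
        tauto)
    set A' := A ∪ C'.sup id with hA'
    have hAA' : A ⊆ A' := subset_union_left
    have hC'A' : ∀ α ∈ C', α ⊆ A' := fun α hα => (le_sup (f := id) hα).trans subset_union_right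
    obtain ⟨B', ts, hr, hts, hn⟩ := exists_tiling_simplex (hne σ (by simp)) A'
      (hσA.trans hAA') (σ.powerset.filter (fun τ => τ ≠ ∅ ∧ τ ∈ L))
      (by
        intro τ hτ
        simp only [mem_filter, mem_powerset] at hτ
        refine ⟨hτ.2.1, lt_of_le_of_ne hτ.1 ?_⟩
        rintro rfl
        exact hσL0 hτ.2.2)
      (by
        intro τ hτ ρ hρ hρ0
        simp only [mem_filter, mem_powerset] at hτ ⊢
        exact ⟨hρ.trans hτ.1, hρ0, hL τ hτ.2.2 ρ hρ⟩)
    have hB0 : σ.powerset.filter (fun τ => τ ≠ ∅ ∧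
        τ ∉ σ.powerset.filter (fun τ => τ ≠ ∅ ∧ τ ∈ L)) = B := by
      ext α
      simp only [hB, mem_filter, mem_powerset]
      tauto
    rw [hB0] at hr
    have hC'σ : ∀ α ∈ C', ¬ α ⊆ σ := by
      intro α hα hle
      rcases mem_or_new_vertex hr' α hα with h | ⟨v, hv, hvA⟩
      · exact (mem_filter.1 h).2 hle
      · exact hvA (hσA (hle hv))
    have hC'c : ∀ α ∈ C', α.card ≤ σ.card := by
      intro α hα
      obtain ⟨T, hT, hαT⟩ := (hts'.2.1 α).1 hα
      obtain ⟨σ', hσ', hTσ'⟩ := hn' T hT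
      exact (card_le_card (T.subset_simplex hαT)).trans (hTσ'.le.trans (hσ σ' hσ').1)
    have hr1 : ReflTransGen (FacetStep (fun _ => True) A) (C ∪ B) (C' ∪ B) := by
      refine reach_union hr' ?_ ?_
      · exact fun α hα => (mem_powerset.1 (mem_filter.1 hα).1).trans hσA
      · intro θ hθ _ α hα hle
        exact (mem_filter.1 hθ).2 (hle.trans (mem_powerset.1 (mem_filter.1 hα).1))
    have hr2 : ReflTransGen (FacetStep (fun θ => θ.card = σ.card) A') (B ∪ C') (B' ∪ C') := by
      refine reach_union hr hC'A' ?_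
      intro θ hθ hcard α hα hle
      have hθσ := eq_of_subset_of_card_le (mem_powerset.1 (mem_filter.1 hθ).1) hcard.ge
      have := eq_of_subset_of_card_le hle ((hC'c α hα).trans hcard.ge)
      exact hC'σ α hα (by rw [← this, hθσ])
    refine ⟨B' ∪ C', ts ++ ts', ?_, ⟨?_, ?_, ?_⟩, ?_, ?_⟩
    · rw [hSBC]
      refine hr1.trans ?_
      rw [union_comm]
      exact hr2.lift id (fun _ _ h => FacetStep.mono (fun _ _ => trivial) hAA' h)
    · refine List.pairwise_append.2 ⟨hts.1, hts'.1, ?_⟩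
      intro T hT T' hT' τ hτ α hα hle
      have hτC : τ ∈ C' := (hts'.2.1 τ).2 ⟨T', hT', hτ⟩
      refine hC'σ τ hτC fun x hx => ?_
      exact old_vertex_mem hr (fun β hβ => mem_powerset.1 (mem_filter.1 hβ).1) α
        ((hts.2.1 α).2 ⟨T, hT, hα⟩) x (hle hx) (hC'A' τ hτC hx)
    · intro α
      simp only [mem_union, hts.2.1, hts'.2.1, List.mem_append, or_and_right, exists_or]
    · intro T hT
      rcases List.mem_append.1 hT with h | h
      exacts [hts.2.2 T h, hts'.2.2 T h]
    · refine List.pairwise_append.2 ⟨?_, hc', ?_⟩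
      · rw [List.pairwise_iff_getElem]
        intro i j hi hj _
        rw [hn _ (List.getElem_mem hi), hn _ (List.getElem_mem hj)]
      · intro T hT T' hT'
        obtain ⟨σ', hσ', h⟩ := hn' T' hT'
        rw [hn T hT, h]
        exact (hσ σ' hσ').1
    · intro T hT
      rcases List.mem_append.1 hT with h | h
      · exact ⟨σ, by simp, hn T h⟩
      · obtain ⟨σ', hσ', h⟩ := hn' T h
        exact ⟨σ', by simp [hσ'], h⟩


theorem mem_relFaces {K L : Finset (Finset V)} {α : Finset V} :
    α ∈ relFaces K L ↔ (α ∈ K ∧ α ∉ L) ∧ α ≠ ∅ := by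
  simp only [relFaces, mem_filter, mem_sdiff]

section Stellar

variable {K L : Finset (Finset V)} {θ : Finset V} {v : V}

theorem IsFacetOf.of_relFaces (hL : IsComplex L) (hθ : IsFacetOf (relFaces K L) θ) :
    IsFacetOf K θ := by
  obtain ⟨h1, h2⟩ := hθ
  obtain ⟨⟨hK, hθL⟩, hθ0⟩ := mem_relFaces.1 h1
  refine ⟨hK, fun σ hσ hle => h2 σ (mem_relFaces.2 ⟨⟨hσ, fun h => hθL (hL σ h θ hle)⟩, ?_⟩) hle⟩
  rintro rfl
  exact hθ0 (subset_empty.1 hle)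

theorem mem_stellar_facet (hK : IsComplex K) (hθ : IsFacetOf K θ) (hv : v ∉ θ) {α : Finset V} :
    α ∈ stellar K θ v ↔ (α ≠ θ ∧ α ∈ K) ∨ (v ∈ α ∧ α.erase v ⊂ θ) := by
  simp only [stellar, mem_union, mem_filter, mem_image]
  refine or_congr ?_ ?_
  · constructor
    · rintro ⟨h1, h2⟩
      exact ⟨fun h => h2 h.ge, h1⟩
    · rintro ⟨h1, h2⟩
      exact ⟨h2, fun h => h1 (hθ.2 α h2 h)⟩
  · constructor
    · rintro ⟨ρ, ⟨h1, h2, h3⟩, rfl⟩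
      have hρ : ρ ⊆ θ := subset_union_left.trans (hθ.2 _ h3 subset_union_right).le
      rw [erase_insert (fun h => hv (hρ h))]
      exact ⟨mem_insert_self _ _, hρ, h2⟩
    · rintro ⟨h1, h2⟩
      refine ⟨α.erase v, ⟨hK θ hθ.1 _ h2.subset, h2.not_subset, ?_⟩, insert_erase h1⟩
      rw [union_eq_right.2 h2.subset]
      exact hθ.1

theorem stellar_of_notMem (hL : IsComplex L) (hθ : θ ∉ L) : stellar L θ v = L := by
  ext α
  simp only [stellar, mem_union, mem_filter, mem_image]
  constructor
  · rintro (h | ⟨ρ, ⟨_, _, h⟩, _⟩)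
    · exact h.1
    · exact absurd (hL _ h θ subset_union_right) hθ
  · exact fun h => Or.inl ⟨h, fun h' => hθ (hL α h θ h')⟩

theorem isComplex_stellar_facet (hK : IsComplex K) (hθ : IsFacetOf K θ) (hv : v ∉ θ) :
    IsComplex (stellar K θ v) := by
  intro α hα β hβ
  rw [mem_stellar_facet hK hθ hv] at hα ⊢
  rcases hα with ⟨h1, h2⟩ | ⟨h1, h2⟩
  · refine Or.inl ⟨?_, hK α h2 β hβ⟩
    rintro rfl
    exact h1 (hθ.2 α h2 hβ)
  · by_cases h : v ∈ β
    · exact Or.inr ⟨h, lt_of_le_of_lt (erase_subset_erase v hβ) h2⟩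
    · have h3 : β ⊂ θ := lt_of_le_of_lt (subset_erase.2 ⟨hβ, h⟩) h2
      exact Or.inl ⟨h3.ne, hK θ hθ.1 β h3.subset⟩

theorem relFaces_stellar_facet (hK : IsComplex K) (hθ : IsFacetOf K θ) (hv : v ∉ θ)
    (hvL : ∀ α ∈ L, v ∉ α) :
    relFaces (stellar K θ v) L = facetSubdivision (relFaces K L) θ v := by
  ext α
  rw [mem_relFaces, mem_stellar_facet hK hθ hv, mem_facetSubdivision hv, mem_relFaces]
  have h1 := hvL α
  have h2 : v ∈ α → α ≠ ∅ := ne_empty_of_mem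
  tauto

end Stellar

/-- A chain of facet subdivisions of the faces of `K ∖ L` is realised by stellar subdivisions. -/
theorem exists_stellar_sequence [Nonempty V] {A : Finset V} {S S' : Finset (Finset V)}
    (h : ReflTransGen (FacetStep (fun _ => True) A) S S') {L : Finset (Finset V)}
    (hL : IsComplex L) (hLA : ∀ α ∈ L, α ⊆ A) (K₀ : Finset (Finset V)) (hK : IsComplex K₀)
    (hS : relFaces K₀ L = S) :
    ∃ (N : ℕ) (K : ℕ → Finset (Finset V)) (θ : ℕ → Finset V) (v : ℕ → V),
      K 0 = K₀ ∧
      (∀ i < N,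
        IsFacetOf (relFaces (K i) L) (θ i) ∧
        (∀ τ ∈ K i, v i ∉ τ) ∧
        K (i + 1) = stellar (K i) (θ i) (v i) ∧
        L = stellar L (θ i) (v i)) ∧
      relFaces (K N) L = S' := by
  induction h using ReflTransGen.head_induction_on generalizing K₀ with
  | refl =>
    exact ⟨0, fun _ => K₀, fun _ => ∅, fun _ => Classical.arbitrary V, rfl, by simp, hS⟩
  | head hs _ ih =>
    obtain ⟨θ₀, v₀, -, hθ, hvA, hv, rfl⟩ := hs
    subst hS
    have hvL : ∀ α ∈ L, v₀ ∉ α := fun α hα h => hvA (hLA α hα h)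
    have hθL : θ₀ ∉ L := (mem_relFaces.1 hθ.1).1.2
    have hθK := hθ.of_relFaces hL
    have hvK : ∀ τ ∈ K₀, v₀ ∉ τ := by
      intro τ hτ h
      exact hv τ (mem_relFaces.2 ⟨⟨hτ, fun hτL => hvL τ hτL h⟩, ne_empty_of_mem h⟩) h
    have hvθ := hv _ hθ.1
    obtain ⟨N, K, θ, v, h0, hstep, hN⟩ := ih (stellar K₀ θ₀ v₀)
      (isComplex_stellar_facet hK hθK hvθ) (relFaces_stellar_facet hK hθK hvθ hvL)
    refine ⟨N + 1, fun i => Nat.casesOn i K₀ K, fun i => Nat.casesOn i θ₀ θ,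
      fun i => Nat.casesOn i v₀ v, rfl, ?_, hN⟩
    rintro (_ | i) hi
    · exact ⟨hθ, hvK, h0, (stellar_of_notMem hL hθL).symm⟩
    · exact hstep i (by omega)

/-- every finite relative simplicial complex carries a shellable
h-tiling after finitely many stellar subdivisions at facets. -/
theorem relative_complex_htiling_after_stellar_subdivisions
    {V : Type*} [DecidableEq V] [Infinite V] (K0 L0 : Finset (Finset V))
    (hK : IsComplex K0) (hL : IsComplex L0) (hLK : L0 ⊆ K0)
    (hfac : ∀ σ, IsFacetOf K0 σ → σ ∉ L0) :
    ∃ (N : ℕ) (K L : ℕ → Finset (Finset V)) (θ : ℕ → Finset V) (v : ℕ → V),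
      K 0 = K0 ∧ L 0 = L0 ∧
      (∀ i < N,
        IsFacetOf (relFaces (K i) (L i)) (θ i) ∧
        (∀ τ ∈ K i, v i ∉ τ) ∧
        K (i + 1) = stellar (K i) (θ i) (v i) ∧
        L (i + 1) = stellar (L i) (θ i) (v i)) ∧
      ∃ ts : List (MorseTile V), IsHShelling (relFaces (K N) (L N)) ts := by
  classical
  let F := (K0.filter (fun σ => IsFacetOf K0 σ ∧ σ ≠ ∅)).toList
  let le : Finset V → Finset V → Bool := fun σ σ' => decide (σ'.card ≤ σ.card)
  let σs := F.mergeSort le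
  have hmem : ∀ σ, σ ∈ σs ↔ IsFacetOf K0 σ ∧ σ ≠ ∅ := by
    intro σ
    simp only [σs, F, List.mem_mergeSort, mem_toList, mem_filter]
    exact ⟨fun h => h.2, fun h => ⟨h.1.1, h⟩⟩
  have hsorted : σs.Pairwise (fun σ σ' => σ'.card ≤ σ.card) := by
    refine (List.pairwise_mergeSort (le := le) ?_ ?_ F).imp (fun h => of_decide_eq_true h)
    · intro a b c h1 h2
      simp only [le, decide_eq_true_eq] at h1 h2 ⊢
      omega
    · intro a b
      simp only [le, Bool.or_eq_true, decide_eq_true_eq]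
      omega
  have hnodup : σs.Nodup := (List.mergeSort_perm F le).nodup_iff.2 (nodup_toList _)
  have hpair : σs.Pairwise (fun σ σ' => σ'.card ≤ σ.card ∧ ¬ σ' ⊆ σ) := by
    refine (hsorted.and hnodup).imp_of_mem ?_
    intro σ σ' hσ hσ' h
    refine ⟨h.1, fun hle => h.2 ?_⟩
    exact ((hmem σ').1 hσ').1.2 σ ((hmem σ).1 hσ).1.1 hle
  have hKA : ∀ α ∈ K0, α ⊆ K0.sup id := fun α hα => le_sup (f := id) hα
  obtain ⟨S', ts, hr, hts, hc, -⟩ := exists_tiling_facets σs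
    (fun σ h => nonempty_of_ne_empty ((hmem σ).1 h).2) hpair (K0.sup id)
    (fun σ h => hKA σ ((hmem σ).1 h).1.1) L0 hL (fun σ h => hfac σ ((hmem σ).1 h).1)
    (relFaces K0 L0) (by
      intro α
      rw [mem_relFaces]
      constructor
      · rintro ⟨⟨h1, h2⟩, h3⟩
        obtain ⟨σ, hle, hσ⟩ := K0.exists_le_maximal h1
        refine ⟨h3, h2, σ, (hmem σ).2
          ⟨⟨hσ.prop, fun τ hτ hστ => (hσ.eq_of_le hτ hστ).symm⟩, ?_⟩, hle⟩
        rintro rfl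
        exact h3 (subset_empty.1 hle)
      · rintro ⟨h1, h2, σ, hσ, hle⟩
        exact ⟨⟨hK σ ((hmem σ).1 hσ).1.1 α hle, h2⟩, h1⟩)
  obtain ⟨N, K, θ, v, h0, hstep, hN⟩ :=
    exists_stellar_sequence hr hL (fun α hα => hKA α (hLK hα)) K0 hK rfl
  exact ⟨N, K, fun _ => L0, θ, v, h0, rfl, hstep, ts, hN ▸ hts.isHShelling hc⟩
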